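/- For all natural numbers n, r, k with k ≤ r ≤ n, the identity C(n+k, n−r) · C(n+r+1, n+k+1) = C(n+k, k) · C(n, r) · C(n+r+1, r−k) · (r! · k!)/(r+k)! holds (as an identity of rational numbers), where C(a,b) denotes the binomial coefficient. -/

import Mathlib

theorem binomial_identity (n r k : ℕ) (hkr : k ≤ r) (hrn : r ≤ n) :
    ((n + k).choose (n - r) : ℚ) * ((n + r + 1).choose (n + k + 1) : ℚ) =
      ((n + k).choose k : ℚ) * (n.choose r : ℚ) * ((n + r + 1).choose (r - k) : ℚ) *
        ((r.factorial : ℚ) * (k.factorial : ℚ)) / ((r + k).factorial : ℚ) := by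
  have hsymm : (n + r + 1).choose (n + k + 1) = (n + r + 1).choose (r - k) :=
    Nat.choose_symm_of_eq_add (by omega)
  rw [hsymm, Nat.cast_choose ℚ (show n - r ≤ n + k by omega),
    Nat.cast_choose ℚ (Nat.le_add_left k n), Nat.cast_choose ℚ hrn,
    show n + k - (n - r) = r + k by omega, Nat.add_sub_cancel]
  have hfact (m : ℕ) : (m.factorial : ℚ) ≠ 0 := Nat.cast_ne_zero.mpr m.factorial_ne_zero
  field_simp [hfact]
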